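/- arXiv:0705.1279 — 2 statements merged into one kernel-verified Lean document; each statement's English description precedes it below -/
import Mathlib

section
/- Let 𝔨 be a finite-dimensional simple real Lie algebra whose Killing form is negative definite (i.e., 𝔨 is a compact simple Lie algebra). If 𝔨₁, 𝔨₂ ≤ 𝔨 are Lie subalgebras with 𝔨₁ ∩ 𝔨₂ = {0} and 𝔨₁ + 𝔨₂ = 𝔨 as vector spaces, then 𝔨₁ = {0} or 𝔨₂ = {0}. That is, a compact simple Lie algebra cannot be written as a vector-space direct sum of two non-zero subalgebras. -/
set_option maxSynthPendingDepth 3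

open Module

theorem exists_ker_add_range {V : Type*} [AddCommGroup V] [Module ℝ V] [FiniteDimensional ℝ V]
    (T : V →ₗ[ℝ] V) (hT : ∀ v, T (T v) = 0 → T v = 0) (v : V) :
    ∃ u w, T u = 0 ∧ v = u + T w := by
  have hker : LinearMap.ker (T ∘ₗ T) = LinearMap.ker T := by
    ext u
    simp only [LinearMap.mem_ker, LinearMap.comp_apply]
    exact ⟨hT u, fun h => by rw [h, map_zero]⟩
  have hle : LinearMap.range (T ∘ₗ T) ≤ LinearMap.range T := LinearMap.range_comp_le_range T T
  have heq : LinearMap.range (T ∘ₗ T) = LinearMap.range T := by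
    apply Submodule.eq_of_le_of_finrank_eq hle
    have h1 := LinearMap.finrank_range_add_finrank_ker (T ∘ₗ T)
    have h2 := LinearMap.finrank_range_add_finrank_ker T
    rw [hker] at h1
    omega
  obtain ⟨w, hw⟩ : T v ∈ LinearMap.range (T ∘ₗ T) := heq ▸ LinearMap.mem_range_self T v
  exact ⟨v - T w, w, by rw [map_sub, ← hw]; simp, by abel⟩

/-- `e` is an orthonormal basis of `k` for the invariant bilinear form `β`. -/
structure IsInvariantFrame {k : Type*} [LieRing k] [LieAlgebra ℝ k] {n : ℕ}
    (β : k →ₗ[ℝ] k →ₗ[ℝ] ℝ) (e : Basis (Fin n) ℝ k) : Prop where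
  apply_basis : ∀ i j, β (e i) (e j) = if i = j then 1 else 0
  lie_left : ∀ x y z : k, β ⁅x, y⁆ z = -β y ⁅x, z⁆

/-- The inner product space structure given by a positive definite symmetric bilinear form. -/
@[reducible] noncomputable def innerCoreOfPosDef {V : Type*} [AddCommGroup V] [Module ℝ V]
    (β : V →ₗ[ℝ] V →ₗ[ℝ] ℝ) (hs : ∀ x y, β x y = β y x) (hp : ∀ x, x ≠ 0 → 0 < β x x) :
    InnerProductSpace.Core ℝ V where
  inner x y := β x y
  conj_inner_symm x y := by simp [hs x y]
  re_inner_nonneg x := by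
    by_cases h : x = 0
    · simp [h]
    · simpa using (hp x h).le
  add_left x y z := by simp
  smul_left x y r := by simp
  definite x h := by
    by_contra h0
    exact (hp x h0).ne' h

theorem exists_orthonormal_basis {V : Type*} [AddCommGroup V] [Module ℝ V] [FiniteDimensional ℝ V]
    (β : V →ₗ[ℝ] V →ₗ[ℝ] ℝ) (hs : ∀ x y, β x y = β y x) (hp : ∀ x, x ≠ 0 → 0 < β x x) :
    ∃ e : Basis (Fin (finrank ℝ V)) ℝ V, ∀ i j, β (e i) (e j) = if i = j then 1 else 0 := by
  let c := innerCoreOfPosDef β hs hp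
  let _ : NormedAddCommGroup V := c.toNormedAddCommGroup
  let _ : InnerProductSpace ℝ V := InnerProductSpace.ofCore c.toCore
  refine ⟨(stdOrthonormalBasis ℝ V).toBasis, fun i j => ?_⟩
  rw [OrthonormalBasis.coe_toBasis]
  exact orthonormal_iff_ite.mp (stdOrthonormalBasis ℝ V).orthonormal i j

namespace IsInvariantFrame

variable {k : Type*} [LieRing k] [LieAlgebra ℝ k] {n : ℕ}
  {β : k →ₗ[ℝ] k →ₗ[ℝ] ℝ} {e : Basis (Fin n) ℝ k}

theorem sum_repr (h : IsInvariantFrame β e) (x : k) : ∑ i, β (e i) x • e i = x := by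
  conv_rhs => rw [← e.sum_repr x]
  refine Finset.sum_congr rfl fun i _ => ?_
  congr 1
  conv_lhs => rw [← e.sum_repr x]
  simp only [map_sum, map_smul, h.apply_basis]
  simp

theorem comm (h : IsInvariantFrame β e) (x y : k) : β x y = β y x := by
  have : β = β.flip := e.ext fun i => e.ext fun j => by simp [h.apply_basis, eq_comm]
  exact LinearMap.congr_fun₂ this x y

theorem lie_right (h : IsInvariantFrame β e) (x y z : k) : β ⁅x, y⁆ z = β x ⁅y, z⁆ := by
  rw [← lie_skew, map_neg, LinearMap.neg_apply, h.lie_left, neg_neg]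

theorem self_eq_sum (h : IsInvariantFrame β e) (x : k) : β x x = ∑ i, β (e i) x ^ 2 := by
  conv_lhs => enter [2]; rw [← h.sum_repr x]
  simp [pow_two, h.comm x]

theorem eq_zero_of_self (h : IsInvariantFrame β e) {x : k} (hx : β x x = 0) : x = 0 := by
  rw [h.self_eq_sum, Finset.sum_eq_zero_iff_of_nonneg fun i _ => sq_nonneg _] at hx
  rw [← h.sum_repr x]
  exact Finset.sum_eq_zero fun i hi => by simp [pow_eq_zero_iff two_ne_zero |>.1 (hx i hi)]

theorem ext_of_apply (h : IsInvariantFrame β e) {x : k} (hx : ∀ y, β x y = 0) : x = 0 :=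
  h.eq_zero_of_self (hx x)

theorem sum_adjoint (h : IsInvariantFrame β e) {N : Type*} [AddCommGroup N] [Module ℝ N]
    {A A' : k →ₗ[ℝ] k} (hA : ∀ x y, β (A x) y = β x (A' y)) (φ : k →ₗ[ℝ] k →ₗ[ℝ] N) :
    ∑ i, φ (A (e i)) (e i) = ∑ i, φ (e i) (A' (e i)) := by
  have h1 : ∀ i, φ (A (e i)) (e i) = ∑ j, β (A (e i)) (e j) • φ (e j) (e i) := fun i => by
    conv_lhs => rw [← h.sum_repr (A (e i))]
    simp [h.comm]
  have h2 : ∀ j, φ (e j) (A' (e j)) = ∑ i, β (e i) (A' (e j)) • φ (e j) (e i) := fun j => by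
    conv_lhs => rw [← h.sum_repr (A' (e j))]
    simp
  simp only [h1, h2, hA]
  exact Finset.sum_comm

theorem sum_lie_left (h : IsInvariantFrame β e) {N : Type*} [AddCommGroup N] [Module ℝ N]
    (x : k) (φ : k →ₗ[ℝ] k →ₗ[ℝ] N) :
    ∑ i, φ ⁅x, e i⁆ (e i) = -∑ i, φ (e i) ⁅x, e i⁆ := by
  have := h.sum_adjoint (A := LieAlgebra.ad ℝ k x) (A' := -LieAlgebra.ad ℝ k x)
    (fun y z => by simp only [LieAlgebra.ad_apply, LinearMap.neg_apply, h.lie_left, map_neg]) φ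
  simpa only [LieAlgebra.ad_apply, LinearMap.neg_apply, map_neg, Finset.sum_neg_distrib] using this

theorem apply_lie_self (h : IsInvariantFrame β e) (w x : k) : β x ⁅w, x⁆ = 0 := by
  have := h.lie_left w x x
  rw [h.comm] at this
  linarith

theorem sum_apply_lie_projection (h : IsInvariantFrame β e) {l : LieSubalgebra ℝ k}
    {R E : k →ₗ[ℝ] k} (hR : LinearMap.IsProj l.toSubmodule R)
    (hE : LinearMap.IsProj l.toSubmodule E)
    (hEs : ∀ x y, β (E x) y = β x (E y)) {w : k} (hw : w ∈ l) :
    ∑ i, β (e i) ⁅w, R (e i)⁆ = 0 := by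
  have h1 := h.sum_adjoint hEs (β.compl₂ ((LieAlgebra.ad ℝ k w : k →ₗ[ℝ] k) ∘ₗ R))
  simp only [LinearMap.compl₂_apply, LinearMap.comp_apply, LieAlgebra.ad_apply] at h1
  have h2 : ∀ x, β (E x) ⁅w, R x⁆ = β x ⁅w, R x⁆ := fun x => by
    rw [hEs, hE.map_id _ (l.lie_mem hw (hR.map_mem x))]
  have h3 : ∀ x, β x ⁅w, R (E x)⁆ = 0 := fun x => by
    rw [hR.map_id _ (hE.map_mem x), ← hE.map_id _ (l.lie_mem hw (hE.map_mem x)), ← hEs,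
      h.apply_lie_self]
  simpa only [h2, h3, Finset.sum_const_zero] using h1

theorem sum_lie_projection (h : IsInvariantFrame β e) {k₁ k₂ : LieSubalgebra ℝ k}
    {P E₁ E₂ : k →ₗ[ℝ] k} (hP : LinearMap.IsProj k₁.toSubmodule P)
    (hQ : LinearMap.IsProj k₂.toSubmodule (LinearMap.id - P))
    (hE₁ : LinearMap.IsProj k₁.toSubmodule E₁) (hEs₁ : ∀ x y, β (E₁ x) y = β x (E₁ y))
    (hE₂ : LinearMap.IsProj k₂.toSubmodule E₂) (hEs₂ : ∀ x y, β (E₂ x) y = β x (E₂ y)) :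
    ∑ i, ⁅P (e i), e i⁆ = 0 := by
  have key : ∀ w, β (∑ i, ⁅P (e i), e i⁆) w = ∑ i, β (e i) ⁅w, P (e i)⁆ := fun w => by
    simp only [map_sum, LinearMap.sum_apply]
    refine Finset.sum_congr rfl fun i _ => ?_
    rw [← lie_skew, map_neg, LinearMap.neg_apply, h.lie_right, ← lie_skew, map_neg, neg_neg]
  apply h.ext_of_apply
  intro w
  have hu := h.sum_apply_lie_projection hP hE₁ hEs₁ (hP.map_mem w)
  have hv := h.sum_apply_lie_projection hQ hE₂ hEs₂ (hQ.map_mem w)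
  simp only [LinearMap.sub_apply, LinearMap.id_apply, lie_sub, map_sub, h.apply_lie_self, zero_sub,
    Finset.sum_neg_distrib, Finset.sum_const_zero, sub_lie, Finset.sum_sub_distrib] at hu hv
  rw [key]
  linarith

end IsInvariantFrame

section Trilinear

variable {k : Type*} [LieRing k] [LieAlgebra ℝ k]

/-- Trilinear forms on a real Lie algebra. -/
abbrev TrilinearForm (k : Type*) [LieRing k] [LieAlgebra ℝ k] : Type _ :=
  k →ₗ[ℝ] k →ₗ[ℝ] k →ₗ[ℝ] ℝ

namespace TrilinearForm

theorem lie_apply (a : TrilinearForm k) (x y₁ y₂ y₃ : k) :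
    ⁅x, a⁆ y₁ y₂ y₃ = -(a ⁅x, y₁⁆ y₂ y₃ + a y₁ ⁅x, y₂⁆ y₃ + a y₁ y₂ ⁅x, y₃⁆) := by
  simp only [LieHom.lie_apply, LinearMap.sub_apply, Module.Dual.lie_apply]
  ring

/-- A trilinear form changing sign under the two adjacent transpositions. -/
structure IsAlt (a : TrilinearForm k) : Prop where
  swap₁₂ : ∀ x y z, a x y z = -a y x z
  swap₂₃ : ∀ x y z, a x y z = -a x z y

theorem IsAlt.rotate {a : TrilinearForm k} (ha : a.IsAlt) (x y z : k) : a x y z = a y z x := by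
  rw [ha.swap₁₂, ha.swap₂₃, neg_neg]

theorem IsAlt.lie {a : TrilinearForm k} (ha : a.IsAlt) (x : k) : IsAlt ⁅x, a⁆ where
  swap₁₂ y₁ y₂ y₃ := by
    simp only [lie_apply]
    rw [ha.swap₁₂ ⁅x, y₁⁆, ha.swap₁₂ y₁ ⁅x, y₂⁆, ha.swap₁₂ y₁ y₂]
    ring
  swap₂₃ y₁ y₂ y₃ := by
    simp only [lie_apply]
    rw [ha.swap₂₃ ⁅x, y₁⁆, ha.swap₂₃ y₁ ⁅x, y₂⁆, ha.swap₂₃ y₁ y₂]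
    ring

/-- The trilinear form `(x, y, z) ↦ b ⁅x, y⁆ z`. -/
noncomputable def ofBilin (b : k →ₗ[ℝ] k →ₗ[ℝ] ℝ) : TrilinearForm k :=
  (LieModule.toEnd ℝ k k : k →ₗ[ℝ] Module.End ℝ k).compr₂ b

@[simp] theorem ofBilin_apply (b : k →ₗ[ℝ] k →ₗ[ℝ] ℝ) (x y z : k) :
    ofBilin b x y z = b ⁅x, y⁆ z := rfl

theorem lie_ofBilin (b : k →ₗ[ℝ] k →ₗ[ℝ] ℝ) (x : k) : ⁅x, ofBilin b⁆ = ofBilin ⁅x, b⁆ := by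
  ext y₁ y₂ y₃
  simp only [ofBilin_apply, LieHom.lie_apply, LinearMap.sub_apply,
    Module.Dual.lie_apply, leibniz_lie x y₁ y₂, map_add, LinearMap.add_apply]
  ring

/-- The pairing of trilinear forms determined by a basis. -/
noncomputable def pair {n : ℕ} (e : Basis (Fin n) ℝ k) :
    TrilinearForm k →ₗ[ℝ] TrilinearForm k →ₗ[ℝ] ℝ :=
  LinearMap.mk₂ ℝ
    (fun a c => ∑ i, ∑ j, ∑ l, a (e i) (e j) (e l) * c (e i) (e j) (e l))
    (fun a b c => by simp [add_mul, Finset.sum_add_distrib])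
    (fun r a b => by simp [Finset.mul_sum, mul_assoc])
    (fun a b c => by simp [mul_add, Finset.sum_add_distrib])
    (fun r a b => by simp [Finset.mul_sum, mul_left_comm])

variable {n : ℕ} {e : Basis (Fin n) ℝ k} {β : k →ₗ[ℝ] k →ₗ[ℝ] ℝ}

theorem pair_apply (a c : TrilinearForm k) :
    pair e a c = ∑ i, ∑ j, ∑ l, a (e i) (e j) (e l) * c (e i) (e j) (e l) := rfl

theorem pair_comm (a c : TrilinearForm k) : pair e a c = pair e c a := by
  simp only [pair_apply, mul_comm]

theorem eq_zero_of_pair_self {a : TrilinearForm k} (ha : pair e a a = 0) : a = 0 := by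
  have hnn : ∀ i j l, 0 ≤ a (e i) (e j) (e l) * a (e i) (e j) (e l) :=
    fun i j l => mul_self_nonneg _
  refine e.ext fun i => e.ext fun j => e.ext fun l => ?_
  rw [pair_apply, Finset.sum_eq_zero_iff_of_nonneg
    fun i _ => Finset.sum_nonneg fun j _ => Finset.sum_nonneg fun l _ => hnn i j l] at ha
  have h1 := ha i (Finset.mem_univ i)
  rw [Finset.sum_eq_zero_iff_of_nonneg fun j _ => Finset.sum_nonneg fun l _ => hnn i j l] at h1
  have h2 := h1 j (Finset.mem_univ j)
  rw [Finset.sum_eq_zero_iff_of_nonneg fun l _ => hnn i j l] at h2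
  simpa using h2 l (Finset.mem_univ l)

/-- Precomposition of a trilinear form with a linear map in each argument. -/
noncomputable def comp (a : TrilinearForm k) (A₁ A₂ A₃ : k →ₗ[ℝ] k) : TrilinearForm k :=
  LinearMap.compr₂ (a.compl₁₂ A₁ A₂) (LinearMap.lcomp ℝ ℝ A₃)

@[simp] theorem comp_apply (a : TrilinearForm k) (A₁ A₂ A₃ : k →ₗ[ℝ] k) (x y z : k) :
    a.comp A₁ A₂ A₃ x y z = a (A₁ x) (A₂ y) (A₃ z) := rfl

theorem pair_comp (h : IsInvariantFrame β e) {A₁ A₂ A₃ B₁ B₂ B₃ : k →ₗ[ℝ] k}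
    (h₁ : ∀ x y, β (A₁ x) y = β x (B₁ y)) (h₂ : ∀ x y, β (A₂ x) y = β x (B₂ y))
    (h₃ : ∀ x y, β (A₃ x) y = β x (B₃ y)) (a c : TrilinearForm k) :
    pair e (a.comp A₁ A₂ A₃) c = pair e a (c.comp B₁ B₂ B₃) := by
  have key : ∀ {A B : k →ₗ[ℝ] k}, (∀ x y, β (A x) y = β x (B y)) → ∀ f g : k →ₗ[ℝ] ℝ,
      ∑ i, f (A (e i)) * g (e i) = ∑ i, f (e i) * g (B (e i)) := fun hAB f g => by
    simpa using h.sum_adjoint hAB ((LinearMap.mul ℝ ℝ).compl₁₂ f g)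
  simp only [pair_apply, comp_apply]
  calc _ = ∑ i, ∑ j, ∑ l, a (A₁ (e i)) (A₂ (e j)) (e l) * c (e i) (e j) (B₃ (e l)) :=
        Finset.sum_congr rfl fun i _ => Finset.sum_congr rfl fun j _ => key h₃ _ _
    _ = ∑ i, ∑ l, ∑ j, a (A₁ (e i)) (A₂ (e j)) (e l) * c (e i) (e j) (B₃ (e l)) :=
        Finset.sum_congr rfl fun i _ => Finset.sum_comm
    _ = ∑ i, ∑ l, ∑ j, a (A₁ (e i)) (e j) (e l) * c (e i) (B₂ (e j)) (B₃ (e l)) :=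
        Finset.sum_congr rfl fun i _ => Finset.sum_congr rfl fun l _ =>
          key h₂ ((a (A₁ (e i))).flip (e l)) ((c (e i)).flip (B₃ (e l)))
    _ = ∑ l, ∑ j, ∑ i, a (A₁ (e i)) (e j) (e l) * c (e i) (B₂ (e j)) (B₃ (e l)) := by
        rw [Finset.sum_comm]
        exact Finset.sum_congr rfl fun l _ => Finset.sum_comm
    _ = ∑ l, ∑ j, ∑ i, a (e i) (e j) (e l) * c (B₁ (e i)) (B₂ (e j)) (B₃ (e l)) :=
        Finset.sum_congr rfl fun l _ => Finset.sum_congr rfl fun j _ =>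
          key h₁ ((a.flip (e j)).flip (e l)) ((c.flip (B₂ (e j))).flip (B₃ (e l)))
    _ = _ := by
        rw [Finset.sum_comm]
        conv_rhs => rw [Finset.sum_comm]
        refine Finset.sum_congr rfl fun j _ => ?_
        exact Finset.sum_comm

theorem pair_lie (h : IsInvariantFrame β e) (x : k) (a c : TrilinearForm k) :
    pair e ⁅x, a⁆ c = -pair e a ⁅x, c⁆ := by
  have hid : ∀ y z, β (LinearMap.id (R := ℝ) y) z = β y (LinearMap.id (R := ℝ) z) := fun _ _ => rfl
  have had : ∀ y z, β (LieAlgebra.ad ℝ k x y) z = β y ((-LieAlgebra.ad ℝ k x : Module.End ℝ k) z) :=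
    fun y z => by simp only [LieAlgebra.ad_apply, LinearMap.neg_apply, h.lie_left, map_neg]
  have h1 := pair_comp h had hid hid a c
  have h2 := pair_comp h hid had hid a c
  have h3 := pair_comp h hid hid had a c
  have e1 : ∀ d : TrilinearForm k, ⁅x, d⁆ = -(d.comp (LieAlgebra.ad ℝ k x) .id .id
      + d.comp .id (LieAlgebra.ad ℝ k x) .id + d.comp .id .id (LieAlgebra.ad ℝ k x)) := fun d => by
    ext y₁ y₂ y₃
    simp only [lie_apply, LinearMap.add_apply, comp_apply, LinearMap.neg_apply, LinearMap.id_apply,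
      LieAlgebra.ad_apply]
  have e2 : ⁅x, c⁆ = c.comp (-LieAlgebra.ad ℝ k x) .id .id
      + c.comp .id (-LieAlgebra.ad ℝ k x) .id + c.comp .id .id (-LieAlgebra.ad ℝ k x) := by
    ext y₁ y₂ y₃
    simp only [lie_apply, LinearMap.add_apply, comp_apply, LinearMap.neg_apply, LinearMap.id_apply,
      LieAlgebra.ad_apply, map_neg]
    ring
  rw [e2, e1 a]
  simp only [map_neg, map_add, LinearMap.neg_apply, LinearMap.add_apply, h1, h2, h3]

theorem IsAlt.lie_apply {a : TrilinearForm k} (ha : a.IsAlt) (x y₁ y₂ y₃ : k) :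
    ⁅x, a⁆ y₁ y₂ y₃ = -(a ⁅x, y₁⁆ y₂ y₃ + a ⁅x, y₂⁆ y₃ y₁ + a ⁅x, y₃⁆ y₁ y₂) := by
  rw [TrilinearForm.lie_apply, ha.rotate y₁ ⁅x, y₂⁆, ha.rotate y₁ y₂, ha.rotate y₂ ⁅x, y₃⁆]

theorem isAlt_ofBilin (h : IsInvariantFrame β e) : IsAlt (ofBilin β) where
  swap₁₂ x y z := by
    rw [ofBilin_apply, ofBilin_apply, ← lie_skew, map_neg, LinearMap.neg_apply]
  swap₂₃ x y z := by
    simp only [ofBilin_apply]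
    rw [h.lie_right, h.lie_right, ← lie_skew, map_neg]

theorem IsAlt.comp {a : TrilinearForm k} (ha : a.IsAlt) (A : k →ₗ[ℝ] k) :
    IsAlt (a.comp A A A) where
  swap₁₂ _ _ _ := ha.swap₁₂ _ _ _
  swap₂₃ _ _ _ := ha.swap₂₃ _ _ _

theorem _root_.IsInvariantFrame.jacobi (h : IsInvariantFrame β e) (x y z w : k) :
    β ⁅x, y⁆ ⁅z, w⁆ + β ⁅x, z⁆ ⁅w, y⁆ + β ⁅x, w⁆ ⁅y, z⁆ = 0 := by
  rw [h.lie_right, h.lie_right, h.lie_right, ← map_add, ← map_add, lie_jacobi, map_zero]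

/-- An identity expressing the exterior differential of the trilinear form `a` through its Lie
derivatives along the values of the endomorphism `R`. -/
def Balanced (a : TrilinearForm k) (R : k →ₗ[ℝ] k) : Prop :=
  ∀ x y₁ y₂ y₃ : k, ⁅x, a⁆ y₁ y₂ y₃ + a x ⁅y₁, y₂⁆ y₃ + a x ⁅y₂, y₃⁆ y₁ + a x ⁅y₃, y₁⁆ y₂ =
    ⁅R x, a⁆ y₁ y₂ y₃ - ⁅R y₁, a⁆ x y₂ y₃ - ⁅R y₂, a⁆ y₁ x y₃ - ⁅R y₃, a⁆ y₁ y₂ x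

theorem balanced_comp (h : IsInvariantFrame β e) {k₁ k₂ : LieSubalgebra ℝ k} {P : k →ₗ[ℝ] k}
    (hP : LinearMap.IsProj k₁.toSubmodule P)
    (hQ : LinearMap.IsProj k₂.toSubmodule (LinearMap.id - P)) :
    Balanced ((ofBilin β).comp P P P) P := by
  have hPP : ∀ x y, P ⁅P x, P y⁆ = ⁅P x, P y⁆ := fun x y =>
    hP.map_id _ (k₁.lie_mem (hP.map_mem x) (hP.map_mem y))
  have hQQ : ∀ x y, P ⁅x - P x, y - P y⁆ = 0 := fun x y => by
    have := hQ.map_id _ (k₂.lie_mem (hQ.map_mem x) (hQ.map_mem y))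
    simpa using this
  obtain ⟨τ, hτ⟩ : ∃ τ : k → k → k, ∀ x y, τ x y = P ⁅x - P x, P y⁆ := ⟨_, fun _ _ => rfl⟩
  have h1 : ∀ x y, P ⁅P x, y⁆ = ⁅P x, P y⁆ - τ y x := fun x y => by
    rw [hτ, ← hPP x y, ← lie_skew, sub_lie]
    rw [← lie_skew (P x) (P y)]
    simp only [map_neg, map_sub]
    abel
  have h2 : ∀ x y, P ⁅x, y⁆ = ⁅P x, P y⁆ + τ x y - τ y x := fun x y => by
    have := hQQ x y
    rw [lie_sub, map_sub, sub_lie, map_sub, h1, ← hτ, sub_eq_zero, sub_eq_iff_eq_add] at this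
    rw [this]
    abel
  intro x y₁ y₂ y₃
  obtain ⟨ω, hω⟩ : ∃ ω, ω = ofBilin β := ⟨_, rfl⟩
  have ha : ω.IsAlt := hω ▸ isAlt_ofBilin h
  have hskew : ∀ u v : k, ω ⁅u, v⁆ = -ω ⁅v, u⁆ := fun u v => by rw [← lie_skew, map_neg]
  have hswap : ∀ u v t, ω t u v = -ω t v u := fun u v t => ha.swap₂₃ _ _ _
  have hJ := h.jacobi (P x) (P y₁) (P y₂) (P y₃)
  have hB : ∀ u v w z : k, ω ⁅u, v⁆ w z = β ⁅u, v⁆ ⁅w, z⁆ := fun u v w z => by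
    rw [hω, ofBilin_apply, h.lie_right]
  have hB' : ∀ u v w z : k, ω ⁅u, v⁆ w z = ω ⁅w, z⁆ u v := fun u v w z => by
    rw [hB, hB, h.comm]
  rw [← hB, ← hB, ← hB] at hJ
  rw [← hω]
  have hA := ha.comp P
  simp only [hA.lie_apply, hA.rotate x]
  simp only [comp_apply, h1, h2 x, h2 y₁, h2 y₂, h2 y₃]
  simp only [map_add, map_sub, LinearMap.add_apply, LinearMap.sub_apply]
  simp only [hskew (P y₁) (P x), hskew (P y₂) (P x), hskew (P y₃) (P x), hskew (P y₃) (P y₁),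
    hskew (P y₃) (P y₂), hskew (P y₂) (P y₁), LinearMap.neg_apply] at hJ ⊢
  simp only [hB' (P y₁) (P y₂), hB' (P y₁) (P y₃), hB' (P y₂) (P y₃)] at hJ ⊢
  simp only [hskew (P y₂) (P x), hskew (P y₃) (P x), LinearMap.neg_apply] at hJ ⊢
  simp only [hswap (P y₁) (P x), hswap (P y₂) (P x), hswap (P y₃) (P x),
    hswap (P y₃) (P y₁)] at hJ ⊢
  linear_combination 2 * hJ
theorem Balanced.id_sub {a : TrilinearForm k} (ha : a.IsAlt) {R : k →ₗ[ℝ] k}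
    (hR : Balanced a R) : Balanced a (LinearMap.id - R) := fun x y₁ y₂ y₃ => by
  have hskew : ∀ u v : k, a ⁅u, v⁆ = -a ⁅v, u⁆ := fun u v => by rw [← lie_skew, map_neg]
  have h := hR x y₁ y₂ y₃
  simp only [LinearMap.sub_apply, LinearMap.id_apply, sub_lie]
  simp only [ha.lie_apply x, ha.lie_apply y₁, ha.lie_apply y₂, ha.lie_apply y₃, ha.rotate x] at h ⊢
  have hs : ∀ u v t, a t u v = -a t v u := fun u v t => ha.swap₂₃ _ _ _
  simp only [hs y₁ x, hs y₂ x, hs y₃ x, hs y₃ y₁, hskew y₁ x, hskew y₂ x, hskew y₃ x,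
    hskew y₂ y₁, hskew y₃ y₁, hskew y₃ y₂, LinearMap.neg_apply] at h ⊢
  linear_combination -h

/-- The Casimir operator of the basis `e` acting on trilinear forms. -/
noncomputable def casimir (e : Basis (Fin n) ℝ k) : Module.End ℝ (TrilinearForm k) :=
  ∑ i, LieModule.toEnd ℝ k (TrilinearForm k) (e i) * LieModule.toEnd ℝ k (TrilinearForm k) (e i)

theorem casimir_apply (γ : TrilinearForm k) : casimir e γ = ∑ i, ⁅e i, ⁅e i, γ⁆⁆ := by
  simp [casimir, -LieHom.lie_apply]

/-- A trilinear form is closed if it is orthogonal to the forms `(x, y, z) ↦ b ⁅x, y⁆ z` with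
`b` antisymmetric. -/
def IsClosed (e : Basis (Fin n) ℝ k) (γ : TrilinearForm k) : Prop :=
  ∀ b : k →ₗ[ℝ] k →ₗ[ℝ] ℝ, (∀ x y, b x y = -b y x) → pair e (ofBilin b) γ = 0

theorem IsClosed.lie (h : IsInvariantFrame β e) {γ : TrilinearForm k} (hγ : IsClosed e γ) (x : k) :
    IsClosed e ⁅x, γ⁆ := fun b hb => by
  have := pair_lie h x (ofBilin b) γ
  rw [lie_ofBilin, hγ] at this
  · linarith
  · intro y z
    simp only [LieHom.lie_apply, LinearMap.sub_apply, Module.Dual.lie_apply]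
    rw [hb ⁅x, y⁆, hb y]
    ring

theorem sum_pair_lie_eq_zero (h : IsInvariantFrame β e) {R : k →ₗ[ℝ] k}
    (hR : ∑ i, ⁅R (e i), e i⁆ = 0) (a : TrilinearForm k) (G : k →ₗ[ℝ] TrilinearForm k)
    (hG : ∀ x y, ⁅R x, G y⁆ = G ⁅R x, y⁆) : ∑ i, pair e ⁅R (e i), a⁆ (G (e i)) = 0 := by
  simp only [pair_lie h, hG, Finset.sum_neg_distrib, ← map_sum, hR, map_zero, neg_zero]

theorem sum_rotate {ι : Type*} [Fintype ι] (f : ι → ι → ι → ℝ) :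
    ∑ j, ∑ l, ∑ m, f j l m = ∑ j, ∑ l, ∑ m, f l m j := by
  conv_rhs => rw [Finset.sum_comm]
  exact Finset.sum_congr rfl fun j _ => Finset.sum_comm

set_option maxHeartbeats 1000000 in
theorem pair_casimir_eq_zero (h : IsInvariantFrame β e) {R : k →ₗ[ℝ] k}
    (hR : ∑ i, ⁅R (e i), e i⁆ = 0) {a γ : TrilinearForm k} (ha : a.IsAlt) (haR : Balanced a R)
    (hγ : γ.IsAlt) (hcl : IsClosed e γ) (hinv : ∀ x, ⁅R x, γ⁆ = 0) :
    pair e a (casimir e γ) = 0 := by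
  obtain ⟨L, hL⟩ : ∃ L : k →ₗ[ℝ] TrilinearForm k, ∀ x, L x = ⁅x, γ⁆ :=
    ⟨(LieModule.toEnd ℝ k (TrilinearForm k) : k →ₗ[ℝ] Module.End ℝ (TrilinearForm k)).flip γ,
      fun _ => rfl⟩
  have hLL : ∀ x y, ⁅R x, L y⁆ = L ⁅R x, y⁆ := fun x y => by
    rw [hL, hL, leibniz_lie, hinv, lie_zero, add_zero]
  have hLA : ∀ x, IsAlt (L x) := fun x => hL x ▸ hγ.lie x
  have hS0 := sum_pair_lie_eq_zero h hR a L hLL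
  have hS1 := sum_pair_lie_eq_zero h hR a (LinearMap.flip L) fun x y => by
    ext z p q
    have := congr($(hLL x z) y p q)
    simp only [lie_apply, LinearMap.flip_apply] at this ⊢
    linarith
  have hcyc : ∀ i, ∑ j, ∑ l, ∑ m, a (e i) ⁅e j, e l⁆ (e m) * L (e i) (e j) (e l) (e m) = 0 := by
    intro i
    have := hcl.lie h (e i) (a (e i)) (ha.swap₂₃ _)
    rwa [← hL] at this
  have hcyc₁ : ∀ i, ∑ j, ∑ l, ∑ m, a (e i) ⁅e l, e m⁆ (e j) * L (e i) (e j) (e l) (e m) = 0 := by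
    intro i
    rw [← hcyc i, sum_rotate fun j l m => a (e i) ⁅e j, e l⁆ (e m) * L (e i) (e j) (e l) (e m)]
    simp only [← (hLA (e i)).rotate (e _) (e _) (e _)]
  have hcyc₂ : ∀ i, ∑ j, ∑ l, ∑ m, a (e i) ⁅e m, e j⁆ (e l) * L (e i) (e j) (e l) (e m) = 0 := by
    intro i
    rw [← hcyc₁ i, sum_rotate fun j l m => a (e i) ⁅e l, e m⁆ (e j) * L (e i) (e j) (e l) (e m)]
    refine Finset.sum_congr rfl fun j _ => Finset.sum_congr rfl fun l _ =>
      Finset.sum_congr rfl fun m _ => ?_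
    rw [(hLA (e i)).rotate (e j)]
  have hT₁ : ∑ i, ∑ j, ∑ l, ∑ m,
      ⁅R (e j), a⁆ (e i) (e l) (e m) * L (e i) (e j) (e l) (e m) = 0 := by
    rw [← hS1, Finset.sum_comm]
    rfl
  have hT₂ : ∑ i, ∑ j, ∑ l, ∑ m,
      ⁅R (e l), a⁆ (e j) (e i) (e m) * L (e i) (e j) (e l) (e m) = 0 := by
    rw [← hT₁]
    refine Finset.sum_congr rfl fun i _ => ?_
    rw [Finset.sum_comm]
    refine Finset.sum_congr rfl fun l _ => Finset.sum_congr rfl fun j _ =>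
      Finset.sum_congr rfl fun m _ => ?_
    rw [(ha.lie _).swap₁₂, (hLA _).swap₁₂]
    ring
  have hT₃ : ∑ i, ∑ j, ∑ l, ∑ m,
      ⁅R (e m), a⁆ (e j) (e l) (e i) * L (e i) (e j) (e l) (e m) = 0 := by
    rw [← hT₁]
    refine Finset.sum_congr rfl fun i _ => ?_
    rw [sum_rotate fun j l m => ⁅R (e m), a⁆ (e j) (e l) (e i) * L (e i) (e j) (e l) (e m)]
    refine Finset.sum_congr rfl fun j _ => Finset.sum_congr rfl fun l _ =>
      Finset.sum_congr rfl fun m _ => ?_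
    rw [(ha.lie _).rotate (e i) (e l) (e m), (hLA _).rotate (e j) (e l) (e m)]
  have hmain : ∑ i, ∑ j, ∑ l, ∑ m, ⁅e i, a⁆ (e j) (e l) (e m) * L (e i) (e j) (e l) (e m) = 0 := by
    have : ∑ i, ∑ j, ∑ l, ∑ m, (⁅e i, a⁆ (e j) (e l) (e m) * L (e i) (e j) (e l) (e m)
        - ⁅R (e i), a⁆ (e j) (e l) (e m) * L (e i) (e j) (e l) (e m)
        + ⁅R (e j), a⁆ (e i) (e l) (e m) * L (e i) (e j) (e l) (e m)
        + ⁅R (e l), a⁆ (e j) (e i) (e m) * L (e i) (e j) (e l) (e m)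
        + ⁅R (e m), a⁆ (e j) (e l) (e i) * L (e i) (e j) (e l) (e m)
        + a (e i) ⁅e j, e l⁆ (e m) * L (e i) (e j) (e l) (e m)
        + a (e i) ⁅e l, e m⁆ (e j) * L (e i) (e j) (e l) (e m)
        + a (e i) ⁅e m, e j⁆ (e l) * L (e i) (e j) (e l) (e m)) = 0 := by
      refine Finset.sum_eq_zero fun i _ => Finset.sum_eq_zero fun j _ =>
        Finset.sum_eq_zero fun l _ => Finset.sum_eq_zero fun m _ => ?_
      linear_combination L (e i) (e j) (e l) (e m) * haR (e i) (e j) (e l) (e m)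
    simp only [Finset.sum_add_distrib, Finset.sum_sub_distrib, hT₁, hT₂, hT₃, add_zero] at this
    have hc : ∑ i, ∑ j, ∑ l, ∑ m, a (e i) ⁅e j, e l⁆ (e m) * L (e i) (e j) (e l) (e m) = 0 :=
      Finset.sum_eq_zero fun i _ => hcyc i
    have hc₁ : ∑ i, ∑ j, ∑ l, ∑ m, a (e i) ⁅e l, e m⁆ (e j) * L (e i) (e j) (e l) (e m) = 0 :=
      Finset.sum_eq_zero fun i _ => hcyc₁ i
    have hc₂ : ∑ i, ∑ j, ∑ l, ∑ m, a (e i) ⁅e m, e j⁆ (e l) * L (e i) (e j) (e l) (e m) = 0 :=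
      Finset.sum_eq_zero fun i _ => hcyc₂ i
    simp only [pair_apply] at hS0
    rw [hc, hc₁, hc₂, hS0, sub_zero, add_zero, add_zero, add_zero] at this
    exact this
  rw [casimir_apply, map_sum, ← neg_eq_zero, ← Finset.sum_neg_distrib]
  simp only [← pair_lie h, ← hL]
  exact hmain
theorem lie_casimir (h : IsInvariantFrame β e) (w : k) (γ : TrilinearForm k) :
    ⁅w, casimir e γ⁆ = casimir e ⁅w, γ⁆ := by
  obtain ⟨φ, hφ⟩ : ∃ φ : k →ₗ[ℝ] k →ₗ[ℝ] TrilinearForm k, ∀ x y, φ x y = ⁅x, ⁅y, γ⁆⁆ :=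
    ⟨LinearMap.mk₂ ℝ (fun x y => ⁅x, ⁅y, γ⁆⁆) (fun _ _ _ => add_lie _ _ _)
      (fun _ _ _ => smul_lie _ _ _) (fun _ _ _ => by rw [add_lie, lie_add])
      (fun _ _ _ => by rw [smul_lie, lie_smul]), fun _ _ => rfl⟩
  have hsum := h.sum_lie_left w φ
  simp only [hφ] at hsum
  have hterm : ∀ i, ⁅w, ⁅e i, ⁅e i, γ⁆⁆⁆ =
      ⁅⁅w, e i⁆, ⁅e i, γ⁆⁆ + ⁅e i, ⁅⁅w, e i⁆, γ⁆⁆ + ⁅e i, ⁅e i, ⁅w, γ⁆⁆⁆ := fun i => by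
    rw [leibniz_lie w (e i) ⁅e i, γ⁆, leibniz_lie w (e i) γ, lie_add, add_assoc]
  rw [casimir_apply, casimir_apply, lie_sum]
  simp only [hterm, Finset.sum_add_distrib, hsum, neg_add_cancel, zero_add]

theorem pair_casimir (h : IsInvariantFrame β e) (a c : TrilinearForm k) :
    pair e a (casimir e c) = -∑ i, pair e ⁅e i, a⁆ ⁅e i, c⁆ := by
  simp only [casimir_apply, map_sum, pair_lie h, Finset.sum_neg_distrib, neg_neg]

theorem pair_casimir_comm (h : IsInvariantFrame β e) (a c : TrilinearForm k) :
    pair e a (casimir e c) = pair e (casimir e a) c := by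
  rw [pair_comm (casimir e a), pair_casimir h, pair_casimir h]
  simp only [pair_comm]

theorem casimir_eq_zero_of_casimir_casimir (h : IsInvariantFrame β e) {a : TrilinearForm k}
    (ha : casimir e (casimir e a) = 0) : casimir e a = 0 := by
  apply eq_zero_of_pair_self (e := e)
  rw [pair_casimir_comm h, ha, map_zero, LinearMap.zero_apply]

theorem lie_eq_zero_of_casimir (h : IsInvariantFrame β e) {a : TrilinearForm k}
    (ha : casimir e a = 0) (x : k) : ⁅x, a⁆ = 0 := by
  have h0 := pair_casimir h a a
  rw [ha, map_zero, zero_eq_neg, Finset.sum_eq_zero_iff_of_nonneg] at h0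
  · have hi : ∀ i, ⁅e i, a⁆ = 0 := fun i => eq_zero_of_pair_self (h0 i (Finset.mem_univ i))
    rw [← h.sum_repr x, sum_lie]
    exact Finset.sum_eq_zero fun i _ => by rw [smul_lie, hi, smul_zero]
  · intro i _
    rw [pair_apply]
    exact Finset.sum_nonneg fun _ _ => Finset.sum_nonneg fun _ _ => Finset.sum_nonneg fun _ _ =>
      mul_self_nonneg _

/-- The closed alternating trilinear forms invariant under the range of `R`. -/
def closedInvariant (e : Basis (Fin n) ℝ k) (R : k →ₗ[ℝ] k) : Submodule ℝ (TrilinearForm k) where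
  carrier := {γ | γ.IsAlt ∧ IsClosed e γ ∧ ∀ x, ⁅R x, γ⁆ = 0}
  zero_mem' := ⟨⟨by simp, by simp⟩, fun _ _ => by simp, fun x => lie_zero _⟩
  add_mem' := by
    rintro γ δ ⟨h₁, h₂, h₃⟩ ⟨h₁', h₂', h₃'⟩
    refine ⟨⟨fun x y z => ?_, fun x y z => ?_⟩, fun b hb => ?_, fun x => ?_⟩
    · simp only [LinearMap.add_apply, h₁.swap₁₂ x, h₁'.swap₁₂ x, neg_add]
    · simp only [LinearMap.add_apply, h₁.swap₂₃ x y, h₁'.swap₂₃ x y, neg_add]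
    · rw [map_add, h₂ b hb, h₂' b hb, add_zero]
    · rw [lie_add, h₃, h₃', add_zero]
  smul_mem' := by
    rintro r γ ⟨h₁, h₂, h₃⟩
    refine ⟨⟨fun x y z => ?_, fun x y z => ?_⟩, fun b hb => ?_, fun x => ?_⟩
    · simp only [LinearMap.smul_apply, h₁.swap₁₂ x, smul_neg]
    · simp only [LinearMap.smul_apply, h₁.swap₂₃ x y, smul_neg]
    · rw [map_smul, h₂ b hb, smul_zero]
    · rw [lie_smul, h₃, smul_zero]

theorem casimir_mem_closedInvariant (h : IsInvariantFrame β e) {R : k →ₗ[ℝ] k}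
    {γ : TrilinearForm k} (hγ : γ ∈ closedInvariant e R) :
    casimir e γ ∈ closedInvariant e R := by
  have hinv : ∀ x, ⁅R x, casimir e γ⁆ = 0 := fun x => by
    rw [lie_casimir h, hγ.2.2, map_zero]
  have h0 : casimir e γ ∈ closedInvariant e (0 : k →ₗ[ℝ] k) := by
    rw [casimir_apply]
    exact Submodule.sum_mem _ fun i _ =>
      ⟨(hγ.1.lie _).lie _, (hγ.2.1.lie h _).lie h _, fun x => zero_lie _⟩
  exact ⟨h0.1, h0.2.1, hinv⟩

theorem exists_invariant_add_casimir [FiniteDimensional ℝ k] (h : IsInvariantFrame β e)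
    {R : k →ₗ[ℝ] k} {γ : TrilinearForm k} (hγ : γ ∈ closedInvariant e R) :
    ∃ γ₀ δ, γ₀ ∈ closedInvariant e R ∧ δ ∈ closedInvariant e R ∧ (∀ x : k, ⁅x, γ₀⁆ = 0) ∧
      γ = γ₀ + casimir e δ := by
  obtain ⟨T, hT⟩ : ∃ T : closedInvariant e R →ₗ[ℝ] closedInvariant e R,
      ∀ δ, (T δ : TrilinearForm k) = casimir e δ :=
    ⟨LinearMap.restrict (casimir e) fun _ hδ => casimir_mem_closedInvariant h hδ, fun _ => rfl⟩
  have hTT : ∀ v, T (T v) = 0 → T v = 0 := fun v hv => by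
    have hv' := congr_arg Subtype.val hv
    rw [hT, hT] at hv'
    apply Subtype.ext
    rw [hT]
    exact casimir_eq_zero_of_casimir_casimir h hv'
  have : FiniteDimensional ℝ (TrilinearForm k) := inferInstance
  obtain ⟨u, w, hu, huw⟩ := exists_ker_add_range (V := closedInvariant e R) T hTT ⟨γ, hγ⟩
  have hu' := congr_arg Subtype.val hu
  have huw' := congr_arg Subtype.val huw
  rw [hT] at hu'
  rw [Submodule.coe_add, hT] at huw'
  exact ⟨u, w, u.2, w.2, lie_eq_zero_of_casimir h hu', huw'⟩

end TrilinearForm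

end Trilinear

theorem exists_eigenvector_of_symmetric {V : Type*} [AddCommGroup V] [Module ℝ V]
    [FiniteDimensional ℝ V] [Nontrivial V] (β : V →ₗ[ℝ] V →ₗ[ℝ] ℝ) (hs : ∀ x y, β x y = β y x)
    (hp : ∀ x, x ≠ 0 → 0 < β x x) (T : V →ₗ[ℝ] V) (hT : ∀ x y, β (T x) y = β x (T y)) :
    ∃ (s : ℝ) (v : V), v ≠ 0 ∧ T v = s • v := by
  let c := innerCoreOfPosDef β hs hp
  let _ : NormedAddCommGroup V := c.toNormedAddCommGroup
  let _ : InnerProductSpace ℝ V := InnerProductSpace.ofCore c.toCore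
  have hsymm : T.IsSymmetric := hT
  obtain ⟨v, hv⟩ := hsymm.hasEigenvalue_iSup_of_finiteDimensional.exists_hasEigenvector
  exact ⟨_, v, hv.2, hv.apply_eq_smul⟩

namespace IsInvariantFrame

variable {k : Type*} [LieRing k] [LieAlgebra ℝ k] {n : ℕ} {β : k →ₗ[ℝ] k →ₗ[ℝ] ℝ}
  {e : Basis (Fin n) ℝ k}

theorem self_pos (h : IsInvariantFrame β e) {x : k} (hx : x ≠ 0) : 0 < β x x :=
  lt_of_le_of_ne (h.self_eq_sum x ▸ Finset.sum_nonneg fun _ _ => sq_nonneg _)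
    fun h0 => hx (h.eq_zero_of_self h0.symm)

theorem exists_dual (h : IsInvariantFrame β e) :
    ∃ B : (k →ₗ[ℝ] ℝ) →ₗ[ℝ] k, ∀ f z, β (B f) z = f z := by
  refine ⟨∑ j, (LinearMap.applyₗ (e j)).smulRight (e j), fun f z => ?_⟩
  conv_rhs => rw [← h.sum_repr z]
  simp [mul_comm]

theorem ext_of_apply_lie (h : IsInvariantFrame β e) (hC : ∀ x : k, ∑ i, ⁅e i, ⁅e i, x⁆⁆ = -x)
    {x : k} (hx : ∀ y z : k, β x ⁅y, z⁆ = 0) : x = 0 := by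
  apply h.ext_of_apply
  intro y
  rw [← neg_neg y, ← hC, map_sum, Finset.sum_eq_zero fun i _ => hx _ _]

end IsInvariantFrame

namespace TrilinearForm

variable {k : Type*} [LieRing k] [LieAlgebra ℝ k] {n : ℕ} {β : k →ₗ[ℝ] k →ₗ[ℝ] ℝ}
  {e : Basis (Fin n) ℝ k}

theorem IsAlt.apply_lie_of_invariant {γ : TrilinearForm k} (hγ : γ.IsAlt)
    (hinv : ∀ x : k, ⁅x, γ⁆ = 0) (x y z w : k) :
    γ x ⁅y, z⁆ w = γ x y ⁅z, w⁆ - γ x z ⁅y, w⁆ := by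
  have hskew : ∀ u v : k, γ ⁅u, v⁆ = -γ ⁅v, u⁆ := fun u v => by rw [← lie_skew, map_neg]
  have hs : ∀ u v t, γ t u v = -γ t v u := fun u v t => hγ.swap₂₃ _ _ _
  have h1 := congr($(hinv x) y z w)
  have h2 := congr($(hinv y) x z w)
  have h3 := congr($(hinv z) x y w)
  have h4 := congr($(hinv w) x y z)
  simp only [hγ.lie_apply, LinearMap.zero_apply] at h1 h2 h3 h4
  rw [hγ.rotate x, hγ.rotate x y, hγ.rotate y, hγ.rotate x z, hγ.rotate z]
  simp only [hs z x, hs w x, hs w y, hskew y x, hskew z x, hskew z y,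
    hskew w x, hskew w y, hskew w z, LinearMap.neg_apply] at h1 h2 h3 h4 ⊢
  linarith

theorem exists_centroid [LieAlgebra.IsKilling ℝ k] [FiniteDimensional ℝ k]
    (h : IsInvariantFrame β e) (hC : ∀ x : k, ∑ i, ⁅e i, ⁅e i, x⁆⁆ = -x) {γ : TrilinearForm k}
    (hγ : γ.IsAlt) (hinv : ∀ x : k, ⁅x, γ⁆ = 0) :
    ∃ φ : k →ₗ[ℝ] k, ∀ x y z, γ x y z = β (φ x) ⁅y, z⁆ := by
  obtain ⟨D, hD⟩ : ∃ D : k →ₗ[ℝ] k →ₗ[ℝ] k, ∀ x y z, β (D x y) z = γ x y z := by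
    obtain ⟨B, hB⟩ := h.exists_dual
    exact ⟨γ.compr₂ B, fun x y z => hB _ _⟩
  have hin : ∀ x, ∃ u, ∀ y, D x y = ⁅u, y⁆ := fun x => by
    let δ : LieDerivation ℝ k k := ⟨D x, fun y z => by
      rw [← sub_eq_zero]
      apply h.ext_of_apply
      intro w
      have := hγ.apply_lie_of_invariant hinv x y z w
      simp only [map_sub, LinearMap.sub_apply, hD]
      rw [h.lie_left, h.lie_left, hD, hD]
      linarith⟩
    obtain ⟨u, hu⟩ := LieDerivation.IsKilling.exists_eq_ad δ
    exact ⟨u, fun y => (DFunLike.congr_fun hu y).symm.trans (LieDerivation.ad_apply_apply ℝ k u y)⟩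
  obtain ⟨φ, hφ⟩ : ∃ φ : k →ₗ[ℝ] k, ∀ x, φ x = ∑ i, ⁅e i, D x (e i)⁆ :=
    ⟨∑ i, LieAlgebra.ad ℝ k (e i) ∘ₗ D.flip (e i), fun x => by simp⟩
  refine ⟨φ, fun x y z => ?_⟩
  obtain ⟨u, hu⟩ := hin x
  have hφu : φ x = u := by
    rw [hφ, ← neg_neg u, ← hC]
    exact Finset.sum_congr rfl fun i _ => by rw [hu, lie_neg, lie_skew]
  rw [← h.lie_right, hφu, ← hu, hD]

theorem exists_eq_smul_ofBilin [LieAlgebra.IsKilling ℝ k] [LieAlgebra.IsSimple ℝ k]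
    [FiniteDimensional ℝ k] (h : IsInvariantFrame β e) (hC : ∀ x : k, ∑ i, ⁅e i, ⁅e i, x⁆⁆ = -x)
    {γ : TrilinearForm k} (hγ : γ.IsAlt) (hinv : ∀ x : k, ⁅x, γ⁆ = 0) :
    ∃ s : ℝ, γ = s • ofBilin β := by
  obtain ⟨φ, hφ⟩ := exists_centroid h hC hγ hinv
  have h1 : ∀ x y, ⁅φ x, y⁆ = ⁅x, φ y⁆ := fun x y => by
    rw [← sub_eq_zero]
    apply h.ext_of_apply
    intro z
    have := hγ.swap₁₂ x y z
    rw [hφ, hφ, ← h.lie_right, ← h.lie_right] at this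
    rw [map_sub, LinearMap.sub_apply, this, ← lie_skew x, map_neg, LinearMap.neg_apply, sub_self]
  have h2 : ∀ w x, φ ⁅w, x⁆ = ⁅w, φ x⁆ := fun w x => by
    rw [← sub_eq_zero]
    apply h.ext_of_apply_lie hC
    intro y z
    have := congr($(hinv w) x y z)
    simp only [lie_apply, hφ, LinearMap.zero_apply] at this
    rw [map_sub, LinearMap.sub_apply, h.lie_left w, leibniz_lie, map_add]
    linarith
  have hsymm' : ∀ x y z, β (φ x) ⁅y, z⁆ = β x (φ ⁅y, z⁆) := fun x y z => by
    rw [← hφ, hγ.rotate, hφ, h2, ← h1, ← h.lie_right, h.comm]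
  have hsymm : ∀ x y, β (φ x) y = β x (φ y) := fun x y => by
    rw [← neg_neg y, ← hC]
    simp only [map_sum, hsymm']
  have : Nontrivial k := LieAlgebra.IsSimple.nontrivial ℝ k
  obtain ⟨s, v, hv, hsv⟩ := exists_eigenvector_of_symmetric β h.comm (fun x => h.self_pos) φ hsymm
  let I : LieIdeal ℝ k :=
    { LinearMap.ker (φ - s • LinearMap.id) with
      lie_mem := fun {x m} hm => by
        have hm' : φ m - s • m = 0 := hm
        change φ ⁅x, m⁆ - s • ⁅x, m⁆ = 0
        rw [h2, ← lie_smul, ← lie_sub, hm', lie_zero] }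
  have hvI : v ∈ I := by
    change φ v - s • v = 0
    rw [hsv, sub_self]
  have hI : I = ⊤ := (LieAlgebra.IsSimple.eq_bot_or_eq_top I).resolve_left fun hI =>
    hv (by rwa [hI, LieSubmodule.mem_bot] at hvI)
  refine ⟨s, LinearMap.ext fun x => LinearMap.ext fun y => LinearMap.ext fun z => ?_⟩
  have hx : x ∈ I := hI ▸ LieSubmodule.mem_top x
  have hx' : φ x - s • x = 0 := hx
  rw [hφ, sub_eq_zero.1 hx']
  simp [h.lie_right]

end TrilinearForm

theorem exists_symmetric_isProj {V : Type*} [AddCommGroup V] [Module ℝ V] [FiniteDimensional ℝ V]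
    (β : V →ₗ[ℝ] V →ₗ[ℝ] ℝ) (hs : ∀ x y, β x y = β y x) (hp : ∀ x, x ≠ 0 → 0 < β x x)
    (W : Submodule ℝ V) :
    ∃ E : V →ₗ[ℝ] V, LinearMap.IsProj W E ∧ ∀ x y, β (E x) y = β x (E y) := by
  let c := innerCoreOfPosDef β hs hp
  let _ : NormedAddCommGroup V := c.toNormedAddCommGroup
  let _ : InnerProductSpace ℝ V := InnerProductSpace.ofCore c.toCore
  exact ⟨W.starProjection, ⟨W.starProjection_apply_mem,
    fun _ hx => Submodule.starProjection_eq_self_iff.2 hx⟩, W.starProjection_isSymmetric⟩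

theorem exists_isProj_of_isCompl {V : Type*} [AddCommGroup V] [Module ℝ V]
    {W₁ W₂ : Submodule ℝ V} (hW : IsCompl W₁ W₂) :
    ∃ P : V →ₗ[ℝ] V, LinearMap.IsProj W₁ P ∧ LinearMap.IsProj W₂ (LinearMap.id - P) := by
  refine ⟨W₁.projection W₂ hW, ⟨Submodule.projection_apply_mem hW,
    fun x hx => Submodule.projection_apply_left hW ⟨x, hx⟩⟩, fun x => ?_, fun x hx => ?_⟩
  · rw [← Submodule.projection_apply_eq_zero_iff hW, LinearMap.sub_apply, LinearMap.id_apply,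
      map_sub, Submodule.projection_apply_left hW ⟨_, Submodule.projection_apply_mem hW x⟩,
      sub_self]
  · rw [LinearMap.sub_apply, (Submodule.projection_apply_eq_zero_iff hW).2 hx, sub_zero,
      LinearMap.id_apply]

namespace IsInvariantFrame

variable {k : Type*} [LieRing k] [LieAlgebra ℝ k] {n : ℕ} {β : k →ₗ[ℝ] k →ₗ[ℝ] ℝ}
  {e : Basis (Fin n) ℝ k}

theorem trace_eq (h : IsInvariantFrame β e) (T : k →ₗ[ℝ] k) :
    LinearMap.trace ℝ k T = ∑ i, β (e i) (T (e i)) := by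
  have hr : ∀ y i, e.repr y i = β (e i) y := fun y i => by
    conv_lhs => rw [← h.sum_repr y]
    simp [Finsupp.single_apply]
  rw [LinearMap.trace_eq_matrix_trace ℝ e]
  simp [Matrix.trace, LinearMap.toMatrix_apply, hr]

theorem sum_lie_lie (h : IsInvariantFrame β e) (hβ : ∀ x y, β x y = -killingForm ℝ k x y) (x : k) :
    ∑ i, ⁅e i, ⁅e i, x⁆⁆ = -x := by
  rw [← sub_eq_zero, sub_neg_eq_add]
  apply h.ext_of_apply
  intro w
  rw [map_add, LinearMap.add_apply, hβ x w, killingForm_apply_apply, h.trace_eq, map_sum,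
    LinearMap.sum_apply, ← sub_eq_add_neg, sub_eq_zero]
  refine Finset.sum_congr rfl fun i _ => ?_
  rw [LinearMap.comp_apply, LieAlgebra.ad_apply, LieAlgebra.ad_apply,
    h.lie_left (e i), h.lie_right, ← lie_skew w, lie_neg, map_neg]

theorem eq_zero_of_abelian (h : IsInvariantFrame β e) (hC : ∀ x : k, ∑ i, ⁅e i, ⁅e i, x⁆⁆ = -x)
    {k₁ k₂ : LieSubalgebra ℝ k} {P : k →ₗ[ℝ] k} (hP : LinearMap.IsProj k₁.toSubmodule P)
    (hQ : LinearMap.IsProj k₂.toSubmodule (LinearMap.id - P)) (hsum : ∑ i, ⁅P (e i), e i⁆ = 0)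
    (hab : ∀ x ∈ k₁, ∀ y ∈ k₁, ⁅x, y⁆ = 0) {w : k} (hw : w ∈ k₁) : w = 0 := by
  have hPP : ∀ x y, ⁅P x, P y⁆ = 0 := fun x y => hab _ (hP.map_mem x) _ (hP.map_mem y)
  have hPw : ∀ x, ⁅P x, w⁆ = 0 := fun x => hab _ (hP.map_mem x) _ hw
  have hder : ∀ x y, P ⁅x, y⁆ = P ⁅P x, y⁆ + P ⁅x, P y⁆ := fun x y => by
    have := hQ.map_id _ (k₂.lie_mem (hQ.map_mem x) (hQ.map_mem y))
    simp only [LinearMap.sub_apply, LinearMap.id_apply, sub_eq_self] at this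
    simp only [lie_sub, sub_lie, map_sub, hPP, map_zero] at this
    rw [← sub_eq_zero, ← this]
    abel
  have h1 : ∑ i, ⁅P (e i), ⁅e i, w⁆⁆ = 0 := by
    have : ∀ i, ⁅P (e i), ⁅e i, w⁆⁆ = ⁅⁅P (e i), e i⁆, w⁆ := fun i => by
      rw [leibniz_lie, hPw, lie_zero, add_zero]
    simp only [this, ← sum_lie, hsum, zero_lie]
  have h2 : ∑ i, ⁅e i, P ⁅e i, w⁆⁆ = 0 := by
    have := h.sum_lie_left w ((LieModule.toEnd ℝ k k : k →ₗ[ℝ] Module.End ℝ k) ∘ₗ P)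
    simp only [LinearMap.comp_apply, LieHom.coe_toLinearMap, LieModule.toEnd_apply_apply] at this
    have e1 : ∀ i, ⁅P ⁅w, e i⁆, e i⁆ = ⁅e i, P ⁅e i, w⁆⁆ := fun i => by
      rw [← lie_skew w, map_neg, neg_lie, lie_skew]
    have e2 : ∀ i, ⁅P (e i), ⁅w, e i⁆⁆ = -⁅P (e i), ⁅e i, w⁆⁆ := fun i => by
      rw [← lie_skew w, lie_neg]
    simpa only [e1, e2, Finset.sum_neg_distrib, h1, neg_zero] using this
  have h3 := congrArg P (hC w)
  rw [map_sum, Finset.sum_congr rfl fun i _ => hder (e i) ⁅e i, w⁆, Finset.sum_add_distrib,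
    ← map_sum, ← map_sum, h1, h2, map_zero, add_zero, map_neg, hP.map_id w hw] at h3
  exact neg_eq_zero.1 h3.symm

end IsInvariantFrame

namespace TrilinearForm

variable {k : Type*} [LieRing k] [LieAlgebra ℝ k] {n : ℕ} {β : k →ₗ[ℝ] k →ₗ[ℝ] ℝ}
  {e : Basis (Fin n) ℝ k}

theorem lie_ofBilin_eq_zero (h : IsInvariantFrame β e) (x : k) : ⁅x, ofBilin β⁆ = 0 := by
  rw [lie_ofBilin]
  have : ⁅x, β⁆ = 0 := by
    ext y z
    simp only [LieHom.lie_apply, LinearMap.sub_apply, Module.Dual.lie_apply, h.lie_left,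
      LinearMap.zero_apply]
    ring
  rw [this]
  rfl

variable {l : LieSubalgebra ℝ k} {E : k →ₗ[ℝ] k}

theorem comp_mem_closedInvariant (h : IsInvariantFrame β e) (hE : LinearMap.IsProj l.toSubmodule E)
    (hEs : ∀ x y, β (E x) y = β x (E y)) {R : k →ₗ[ℝ] k} (hR : ∀ x, R x ∈ l) :
    (ofBilin β).comp E E E ∈ closedInvariant e R := by
  refine ⟨(isAlt_ofBilin h).comp E, fun b hb => ?_, fun x => ?_⟩
  · have hred : pair e (ofBilin b) ((ofBilin β).comp E E E) =
        ∑ i, ∑ j, b ⁅e i, e j⁆ ⁅E (e i), E (e j)⁆ := by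
      rw [pair_apply]
      refine Finset.sum_congr rfl fun i _ => Finset.sum_congr rfl fun j _ => ?_
      conv_rhs => rw [← h.sum_repr ⁅E (e i), E (e j)⁆]
      simp only [ofBilin_apply, comp_apply, map_sum, map_smul, smul_eq_mul]
      refine Finset.sum_congr rfl fun m _ => ?_
      rw [← hEs, hE.map_id _ (l.lie_mem (hE.map_mem _) (hE.map_mem _)), h.comm, mul_comm]
    obtain ⟨Ψ, hΨ⟩ : ∃ Ψ : k →ₗ[ℝ] k →ₗ[ℝ] k →ₗ[ℝ] k →ₗ[ℝ] ℝ,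
        ∀ x y z w, Ψ x y z w = b ⁅x, z⁆ ⁅y, w⁆ :=
      ⟨LinearMap.mk₂ ℝ (fun x y => b.compl₁₂ (LieAlgebra.ad ℝ k x : k →ₗ[ℝ] k)
          (LieAlgebra.ad ℝ k y : k →ₗ[ℝ] k))
        (fun _ _ _ => by ext; simp) (fun _ _ _ => by ext; simp) (fun _ _ _ => by ext; simp)
        (fun _ _ _ => by ext; simp), fun _ _ _ _ => rfl⟩
    have h1 := h.sum_adjoint hEs (∑ j, (Ψ.compr₂ (LinearMap.applyₗ (e j))).compr₂
      (LinearMap.applyₗ (E (e j))))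
    have h2 := h.sum_adjoint hEs (∑ i, Ψ (E (e i)) (e i))
    simp only [LinearMap.sum_apply, LinearMap.compr₂_apply, LinearMap.applyₗ_apply_apply, hΨ]
      at h1 h2
    have h3 : ∑ i, ∑ j, b ⁅e i, e j⁆ ⁅E (e i), E (e j)⁆ =
        -∑ i, ∑ j, b ⁅e i, e j⁆ ⁅E (e i), E (e j)⁆ := by
      conv_lhs => rw [← h1, Finset.sum_comm, ← h2, Finset.sum_comm]
      simp only [← Finset.sum_neg_distrib]
      exact Finset.sum_congr rfl fun i _ => Finset.sum_congr rfl fun j _ => hb _ _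
    rw [hred]
    linarith
  · have hc : ∀ y, E ⁅R x, y⁆ = ⁅R x, E y⁆ := fun y => by
      rw [← sub_eq_zero]
      apply h.ext_of_apply
      intro z
      have hz := hE.map_id _ (l.lie_mem (hR x) (hE.map_mem z))
      have hy := hE.map_id _ (l.lie_mem (hR x) (hE.map_mem y))
      rw [map_sub, LinearMap.sub_apply, ← hy, hEs ⁅R x, E y⁆, hEs, h.lie_left, h.lie_left, hEs y,
        hz, sub_self]
    ext y₁ y₂ y₃
    have := congr($(lie_ofBilin_eq_zero h (R x)) (E y₁) (E y₂) (E y₃))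
    simp only [lie_apply, LinearMap.zero_apply, comp_apply, hc] at this ⊢
    exact this

theorem pair_comp_self (h : IsInvariantFrame β e) (hE : LinearMap.IsProj l.toSubmodule E)
    (hEs : ∀ x y, β (E x) y = β x (E y)) :
    pair e ((ofBilin β).comp E E E) (ofBilin β) =
      pair e ((ofBilin β).comp E E E) ((ofBilin β).comp E E E) := by
  conv_rhs => rw [pair_comm, ← pair_comp h hEs hEs hEs]
  congr 2
  ext x y z
  simp only [comp_apply, hE.map_id _ (hE.map_mem _)]

theorem lie_eq_zero_of_comp_eq_zero (h : IsInvariantFrame β e)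
    (hE : LinearMap.IsProj l.toSubmodule E) (h0 : (ofBilin β).comp E E E = 0) :
    ∀ x ∈ l, ∀ y ∈ l, ⁅x, y⁆ = 0 := fun x hx y hy => by
  have := congr($h0 x y ⁅x, y⁆)
  rw [comp_apply, hE.map_id x hx, hE.map_id y hy, hE.map_id _ (l.lie_mem hx hy)] at this
  exact h.eq_zero_of_self this

theorem exists_pair_eq_mul [LieAlgebra.IsKilling ℝ k] [LieAlgebra.IsSimple ℝ k]
    [FiniteDimensional ℝ k] (h : IsInvariantFrame β e) (hC : ∀ x : k, ∑ i, ⁅e i, ⁅e i, x⁆⁆ = -x)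
    {R : k →ₗ[ℝ] k} (hR : ∑ i, ⁅R (e i), e i⁆ = 0) {a γ : TrilinearForm k} (ha : a.IsAlt)
    (haR : Balanced a R) (hγ : γ ∈ closedInvariant e R) :
    ∃ s : ℝ, pair e a γ = s * pair e a (ofBilin β) ∧
      pair e γ (ofBilin β) = s * pair e (ofBilin β) (ofBilin β) := by
  obtain ⟨γ₀, δ, hγ₀, hδ, hinv, rfl⟩ := exists_invariant_add_casimir h hγ
  obtain ⟨s, rfl⟩ := exists_eq_smul_ofBilin h hC hγ₀.1 hinv
  refine ⟨s, ?_, ?_⟩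
  · rw [map_add, pair_casimir_eq_zero h hR ha haR hδ.1 hδ.2.1 hδ.2.2, map_smul, add_zero,
      smul_eq_mul]
  · have h0 : casimir e (ofBilin β) = 0 := by
      rw [casimir_apply]
      exact Finset.sum_eq_zero fun i _ => by rw [lie_ofBilin_eq_zero h, lie_zero]
    rw [map_add, LinearMap.add_apply, ← pair_casimir_comm h, h0, map_zero, map_smul, add_zero,
      LinearMap.smul_apply, smul_eq_mul]

end TrilinearForm

open TrilinearForm in
theorem IsInvariantFrame.abelian_or_abelian {k : Type*} [LieRing k] [LieAlgebra ℝ k]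
    [FiniteDimensional ℝ k] [LieAlgebra.IsKilling ℝ k] [LieAlgebra.IsSimple ℝ k] {n : ℕ}
    {β : k →ₗ[ℝ] k →ₗ[ℝ] ℝ} {e : Basis (Fin n) ℝ k} (h : IsInvariantFrame β e)
    (hC : ∀ x : k, ∑ i, ⁅e i, ⁅e i, x⁆⁆ = -x) {k₁ k₂ : LieSubalgebra ℝ k} {P E₁ E₂ : k →ₗ[ℝ] k}
    (hP : LinearMap.IsProj k₁.toSubmodule P)
    (hQ : LinearMap.IsProj k₂.toSubmodule (LinearMap.id - P))
    (hE₁ : LinearMap.IsProj k₁.toSubmodule E₁) (hEs₁ : ∀ x y, β (E₁ x) y = β x (E₁ y))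
    (hE₂ : LinearMap.IsProj k₂.toSubmodule E₂) (hEs₂ : ∀ x y, β (E₂ x) y = β x (E₂ y))
    (hsP : ∑ i, ⁅P (e i), e i⁆ = 0) (hsQ : ∑ i, ⁅(LinearMap.id - P : k →ₗ[ℝ] k) (e i), e i⁆ = 0) :
    (∀ x ∈ k₁, ∀ y ∈ k₁, ⁅x, y⁆ = 0) ∨ ∀ x ∈ k₂, ∀ y ∈ k₂, ⁅x, y⁆ = 0 := by
  have hPE₂ : ∀ x, P (E₂ x) = 0 := fun x => by
    simpa [sub_eq_self] using hQ.map_id _ (hE₂.map_mem x)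
  have ha : ((ofBilin β).comp P P P).IsAlt := (isAlt_ofBilin h).comp P
  have hbal : Balanced ((ofBilin β).comp P P P) P := balanced_comp h hP hQ
  have hac₁ : pair e ((ofBilin β).comp P P P) ((ofBilin β).comp E₁ E₁ E₁) =
      pair e ((ofBilin β).comp E₁ E₁ E₁) (ofBilin β) := by
    rw [← pair_comp h hEs₁ hEs₁ hEs₁]
    congr 2
    ext x y z
    simp only [comp_apply, hP.map_id _ (hE₁.map_mem _)]
  have hac₂ : pair e ((ofBilin β).comp P P P) ((ofBilin β).comp E₂ E₂ E₂) = 0 := by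
    rw [← pair_comp h hEs₂ hEs₂ hEs₂]
    have : ((ofBilin β).comp P P P).comp E₂ E₂ E₂ = 0 := by
      ext x y z
      simp only [comp_apply, hPE₂, map_zero, LinearMap.zero_apply]
    rw [this, map_zero, LinearMap.zero_apply]
  obtain ⟨s₁, hs₁, -⟩ := exists_pair_eq_mul h hC hsP ha hbal
    (comp_mem_closedInvariant h hE₁ hEs₁ hP.map_mem)
  obtain ⟨s₂, hs₂, hω₂⟩ := exists_pair_eq_mul h hC hsQ ha (hbal.id_sub ha)
    (comp_mem_closedInvariant h hE₂ hEs₂ hQ.map_mem)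
  rw [hac₂, eq_comm, mul_eq_zero] at hs₂
  rcases hs₂ with rfl | h0
  · right
    rw [zero_mul, pair_comp_self h hE₂ hEs₂] at hω₂
    exact lie_eq_zero_of_comp_eq_zero h hE₂ (eq_zero_of_pair_self hω₂)
  · left
    rw [h0, mul_zero, hac₁, pair_comp_self h hE₁ hEs₁] at hs₁
    exact lie_eq_zero_of_comp_eq_zero h hE₁ (eq_zero_of_pair_self hs₁)

/-- A compact simple real Lie algebra (simple with negative definite Killing form) cannot be
written as a vector-space direct sum of two non-zero subalgebras. -/
theorem compact_simple_lie_algebra_no_decomposition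
    {k : Type*} [LieRing k] [LieAlgebra ℝ k] [FiniteDimensional ℝ k]
    [LieAlgebra.IsSimple ℝ k]
    (hneg : ∀ x : k, x ≠ 0 → killingForm ℝ k x x < 0)
    (k₁ k₂ : LieSubalgebra ℝ k)
    (hsum : k₁.toSubmodule ⊔ k₂.toSubmodule = ⊤)
    (hint : k₁.toSubmodule ⊓ k₂.toSubmodule = ⊥) :
    k₁ = ⊥ ∨ k₂ = ⊥ := by
  obtain ⟨β, hβ⟩ : ∃ β : k →ₗ[ℝ] k →ₗ[ℝ] ℝ, ∀ x y, β x y = -killingForm ℝ k x y :=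
    ⟨-killingForm ℝ k, fun _ _ => rfl⟩
  have hs : ∀ x y, β x y = β y x := fun x y => by
    rw [hβ, hβ, LieModule.traceForm_comm]
  have hp : ∀ x, x ≠ 0 → 0 < β x x := fun x hx => by
    rw [hβ]
    exact neg_pos.2 (hneg x hx)
  obtain ⟨e, he⟩ := exists_orthonormal_basis β hs hp
  have h : IsInvariantFrame β e := ⟨he, fun x y z => by
    rw [hβ, hβ, LieModule.traceForm_apply_lie_apply']⟩
  have hC := h.sum_lie_lie hβ
  obtain ⟨P, hP, hQ⟩ := exists_isProj_of_isCompl (IsCompl.of_eq hint hsum)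
  obtain ⟨E₁, hE₁, hEs₁⟩ := exists_symmetric_isProj β hs hp k₁.toSubmodule
  obtain ⟨E₂, hE₂, hEs₂⟩ := exists_symmetric_isProj β hs hp k₂.toSubmodule
  have hQ' : LinearMap.IsProj k₁.toSubmodule (LinearMap.id - (LinearMap.id - P)) := by
    rwa [sub_sub_cancel]
  have hsP := h.sum_lie_projection hP hQ hE₁ hEs₁ hE₂ hEs₂
  have hsQ := h.sum_lie_projection hQ hQ' hE₂ hEs₂ hE₁ hEs₁
  rcases h.abelian_or_abelian hC hP hQ hE₁ hEs₁ hE₂ hEs₂ hsP hsQ with hab | hab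
  · exact Or.inl ((LieSubalgebra.eq_bot_iff k₁).2 fun x hx =>
      h.eq_zero_of_abelian hC hP hQ hsP hab hx)
  · exact Or.inr ((LieSubalgebra.eq_bot_iff k₂).2 fun x hx =>
      h.eq_zero_of_abelian hC hQ hQ' hsQ hab hx)
end

section
/- Let 𝔨 be a finite-dimensional real Lie algebra carrying an invariant inner product (a positive definite symmetric bilinear form ⟨·,·⟩ with ⟨[x,y],z⟩ = −⟨y,[x,z]⟩ for all x, y, z ∈ 𝔨). Let 𝔨₁, 𝔨₂ ≤ 𝔨 be subalgebras with 𝔨 = 𝔨₁ + 𝔨₂ and 𝔨₁ ∩ 𝔨₂ = {0} (vector-space direct sum). Let 𝔱₁ ≤ 𝔨₁ and 𝔱₂ ≤ 𝔨₂ be maximal abelian subalgebras of 𝔨₁ and 𝔨₂ respectively, and let 𝔱 be a maximal abelian subalgebra of 𝔨 with 𝔱₁ + 𝔱₂ ⊆ 𝔱. Then 𝔱 = 𝔱₁ + 𝔱₂; in particular dim 𝔱 = dim 𝔱₁ + dim 𝔱₂, i.e. the rank of 𝔨 is the sum of the ranks of 𝔨₁ and 𝔨₂. -/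
/-- An abelian Lie subalgebra which is maximal among the abelian subalgebras of `K` contains every
element of `K` commuting with it. -/
theorem LieSubalgebra.mem_of_maximal_abelian {R L : Type*} [CommRing R] [LieRing L]
    [LieAlgebra R L] {K T : LieSubalgebra R L} (hTK : T ≤ K) (hT : IsLieAbelian T)
    (hmax : ∀ S : LieSubalgebra R L, IsLieAbelian S → S ≤ K → T ≤ S → S = T)
    {a : L} (ha : a ∈ K) (hcomm : ∀ h ∈ T, ⁅h, a⁆ = 0) : a ∈ T := by
  have hT' : ∀ x ∈ T, ∀ y ∈ T, ⁅x, y⁆ = 0 := fun x hx y hy =>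
    congrArg Subtype.val (hT.trivial ⟨x, hx⟩ ⟨y, hy⟩)
  have habel : ∀ x ∈ T.toSubmodule ⊔ R ∙ a, ∀ y ∈ T.toSubmodule ⊔ R ∙ a, ⁅x, y⁆ = 0 := by
    intro x hx y hy
    obtain ⟨u, hu, u', hu', rfl⟩ := Submodule.mem_sup.1 hx
    obtain ⟨v, hv, v', hv', rfl⟩ := Submodule.mem_sup.1 hy
    obtain ⟨c, rfl⟩ := Submodule.mem_span_singleton.1 hu'
    obtain ⟨d, rfl⟩ := Submodule.mem_span_singleton.1 hv'
    have hav : ⁅a, v⁆ = 0 := by rw [← lie_skew, hcomm v hv, neg_zero]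
    simp [hT' u hu v hv, hcomm u hu, hav]
  let S : LieSubalgebra R L :=
    { T.toSubmodule ⊔ R ∙ a with
      lie_mem' := fun {x y} hx hy => by
        have h : ⁅x, y⁆ = 0 := habel x hx y hy
        rw [h]
        exact Submodule.zero_mem (T.toSubmodule ⊔ R ∙ a) }
  have hTS : T.toSubmodule ≤ S.toSubmodule := le_sup_left
  have haS : R ∙ a ≤ S.toSubmodule := le_sup_right
  have hSK : S.toSubmodule ≤ K.toSubmodule :=
    sup_le hTK ((Submodule.span_singleton_le_iff_mem a K.toSubmodule).2 ha)
  have hS : S = T := hmax S ⟨fun x y => Subtype.ext (habel x x.2 y y.2)⟩ hSK hTS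
  rw [← hS]
  exact haS (Submodule.mem_span_singleton_self a)

/-- A positive definite symmetric bilinear form on a finite-dimensional space admits orthogonal
projections onto subspaces. -/
theorem LinearMap.BilinForm.exists_orthogonal_projection {V : Type*} [AddCommGroup V] [Module ℝ V]
    [FiniteDimensional ℝ V] {B : LinearMap.BilinForm ℝ V} (hsymm : B.IsSymm)
    (hpos : ∀ x : V, x ≠ 0 → 0 < B x x) (W : Submodule ℝ V) (a : V) :
    ∃ w ∈ W, ∀ y ∈ W, B w y = B a y := by
  have hW : (B.restrict W).Nondegenerate := by
    refine (LinearMap.BilinForm.IsSymm.isRefl (B := B.restrict W)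
      (hsymm.restrict W)).nondegenerate_iff_separatingLeft.2 fun x hx => ?_
    by_contra hne
    exact (hpos x (by simpa using hne)).ne' (hx x)
  have hcompl := LinearMap.BilinForm.isCompl_orthogonal_of_restrict_nondegenerate hsymm.isRefl hW
  obtain ⟨w, hw, z, hz, rfl⟩ :=
    Submodule.mem_sup.1 (hcompl.sup_eq_top ▸ Submodule.mem_top (x := a))
  refine ⟨w, hw, fun y hy => ?_⟩
  have hzy : B z y = 0 := by
    rw [hsymm.eq z y]
    exact hz y hy
  simp [hzy]

/-- Let `T` be a maximal abelian subalgebra of `K`. An element commuting with `T` and orthogonal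
to `T` for a positive definite invariant form is orthogonal to `K`. -/
theorem LieSubalgebra.orthogonal_of_commute_maximal_abelian {L : Type*} [LieRing L]
    [LieAlgebra ℝ L] [FiniteDimensional ℝ L] {B : LinearMap.BilinForm ℝ L} (hsymm : B.IsSymm)
    (hpos : ∀ x : L, x ≠ 0 → 0 < B x x) (hinv : ∀ x y z : L, B ⁅x, y⁆ z = -(B y ⁅x, z⁆))
    {K T : LieSubalgebra ℝ L} (hTK : T ≤ K) (hT : IsLieAbelian T)
    (hmax : ∀ S : LieSubalgebra ℝ L, IsLieAbelian S → S ≤ K → T ≤ S → S = T)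
    {a : L} (hcomm : ∀ h ∈ T, ⁅h, a⁆ = 0) (horth : ∀ h ∈ T, B a h = 0) :
    ∀ y ∈ K, B a y = 0 := by
  obtain ⟨w, hwK, hw⟩ :=
    LinearMap.BilinForm.exists_orthogonal_projection hsymm hpos K.toSubmodule a
  have hwT : w ∈ T := by
    refine LieSubalgebra.mem_of_maximal_abelian hTK hT hmax hwK fun h hh => ?_
    by_contra hne
    have hmem : ⁅h, w⁆ ∈ K := K.lie_mem (hTK hh) hwK
    refine (hpos _ hne).ne' ?_
    rw [hinv, hw _ (K.lie_mem (hTK hh) hmem), ← hinv, hcomm h hh]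
    simp
  have hw0 : w = 0 := by
    by_contra hne
    exact (hpos w hne).ne' ((hw w hwK).trans (horth w hwT))
  intro y hy
  rw [← hw y hy, hw0]
  simp

/-- For a compact Lie algebra `k` (one with an invariant inner product) written as a
vector-space direct sum of subalgebras `k = k₁ ⊕ k₂`, if `t₁ ⊆ k₁` and `t₂ ⊆ k₂` are maximal
abelian subalgebras and `t` is a maximal abelian subalgebra of `k` containing `t₁ + t₂`,
then `t = t₁ + t₂`; in particular the rank of `k` is the sum of the ranks of `k₁` and `k₂`. -/
theorem rank_additive_of_decomposition
    {k : Type*} [LieRing k] [LieAlgebra ℝ k] [FiniteDimensional ℝ k]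
    (B : LinearMap.BilinForm ℝ k) (hsymm : B.IsSymm)
    (hpos : ∀ x : k, x ≠ 0 → 0 < B x x)
    (hinv : ∀ x y z : k, B ⁅x, y⁆ z = -(B y ⁅x, z⁆))
    (k₁ k₂ : LieSubalgebra ℝ k)
    (hsum : k₁.toSubmodule ⊔ k₂.toSubmodule = ⊤)
    (hint : k₁.toSubmodule ⊓ k₂.toSubmodule = ⊥)
    (t₁ t₂ t : LieSubalgebra ℝ k)
    (ht₁k : t₁ ≤ k₁) (ht₁ab : IsLieAbelian t₁)
    (ht₁max : ∀ s : LieSubalgebra ℝ k, IsLieAbelian s → s ≤ k₁ → t₁ ≤ s → s = t₁)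
    (ht₂k : t₂ ≤ k₂) (ht₂ab : IsLieAbelian t₂)
    (ht₂max : ∀ s : LieSubalgebra ℝ k, IsLieAbelian s → s ≤ k₂ → t₂ ≤ s → s = t₂)
    (htab : IsLieAbelian t)
    (htmax : ∀ s : LieSubalgebra ℝ k, IsLieAbelian s → t ≤ s → s = t)
    (hsub : t₁.toSubmodule ⊔ t₂.toSubmodule ≤ t.toSubmodule) :
    t.toSubmodule = t₁.toSubmodule ⊔ t₂.toSubmodule ∧
      Module.finrank ℝ t = Module.finrank ℝ t₁ + Module.finrank ℝ t₂ := by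
  have ht : ∀ x ∈ t, ∀ y ∈ t, ⁅x, y⁆ = 0 := fun x hx y hy =>
    congrArg Subtype.val (htab.trivial ⟨x, hx⟩ ⟨y, hy⟩)
  have h₁ : t₁.toSubmodule ≤ t.toSubmodule := le_sup_left.trans hsub
  have h₂ : t₂.toSubmodule ≤ t.toSubmodule := le_sup_right.trans hsub
  have heq : t.toSubmodule = t₁.toSubmodule ⊔ t₂.toSubmodule := by
    refine le_antisymm (fun a ha => ?_) hsub
    obtain ⟨w, hw, hproj⟩ := LinearMap.BilinForm.exists_orthogonal_projection hsymm hpos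
      (t₁.toSubmodule ⊔ t₂.toSubmodule) a
    have hmem : a - w ∈ t := t.toSubmodule.sub_mem ha (hsub hw)
    have horth : ∀ y ∈ t₁.toSubmodule ⊔ t₂.toSubmodule, B (a - w) y = 0 := fun y hy => by
      simp [hproj y hy]
    have hk₁ := LieSubalgebra.orthogonal_of_commute_maximal_abelian hsymm hpos hinv ht₁k ht₁ab
      ht₁max (fun h hh => ht h (h₁ hh) _ hmem)
      (fun h hh => horth h (Submodule.mem_sup_left hh))
    have hk₂ := LieSubalgebra.orthogonal_of_commute_maximal_abelian hsymm hpos hinv ht₂k ht₂ab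
      ht₂max (fun h hh => ht h (h₂ hh) _ hmem)
      (fun h hh => horth h (Submodule.mem_sup_right hh))
    have hzero : a - w = 0 := by
      by_contra hne
      obtain ⟨y, hy, z, hz, hyz⟩ :=
        Submodule.mem_sup.1 (hsum ▸ Submodule.mem_top (x := a - w))
      refine (hpos _ hne).ne' ?_
      conv_lhs => rw [← hyz, map_add, hyz, hk₁ y hy, hk₂ z hz, add_zero]
    rwa [sub_eq_zero.1 hzero]
  refine ⟨heq, ?_⟩
  have hbot : t₁.toSubmodule ⊓ t₂.toSubmodule = ⊥ :=
    le_bot_iff.1 fun _ hx => hint.le ⟨ht₁k hx.1, ht₂k hx.2⟩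
  have hrank := Submodule.finrank_sup_add_finrank_inf_eq t₁.toSubmodule t₂.toSubmodule
  rw [hbot, finrank_bot, add_zero, ← heq] at hrank
  exact hrank
end
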